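/- (Proposition 3.4 i.) Assume the form polynomial t is strongly damped and D contains a nonzero vector, and let ν_− := sup Λ_− and ν_+ := inf Λ_+ (these are finite real numbers with ν_− ≤ ν_+). Then for every λ ∈ [ν_−, ν_+] and every x ∈ D one has t(λ)[x] ≥ (λ − ν_−)(ν_+ − λ)‖x‖² ≥ 0; in particular the form t(λ) is nonnegative for every λ ∈ [ν_−, ν_+]. -/

import Mathlib

/-- The abstract Klein–Gordon quadratic form `t(λ)[x] = ‖G x‖² − ‖V x − λ x‖²`. -/
noncomputable def kgForm {H : Type*} [NormedAddCommGroup H] [InnerProductSpace ℂ H]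
    {D : Submodule ℂ H} (G V : D →ₗ[ℂ] H) (μ : ℝ) (x : D) : ℝ :=
  ‖G x‖ ^ 2 - ‖V x - (μ : ℂ) • (x : H)‖ ^ 2

/-- The Klein–Gordon form is a real quadratic polynomial in `μ` with leading coefficient
`-‖x‖²`. -/
theorem kgForm_eq_quadratic {H : Type*} [NormedAddCommGroup H] [InnerProductSpace ℂ H]
    {D : Submodule ℂ H} (G V : D →ₗ[ℂ] H) (μ : ℝ) (x : D) :
    kgForm G V μ x = ‖G x‖ ^ 2 - ‖V x‖ ^ 2 + 2 * μ * (inner ℂ (V x) (x : H)).re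
      - μ ^ 2 * ‖(x : H)‖ ^ 2 := by
  have h := norm_sub_sq (𝕜 := ℂ) (V x) ((μ : ℂ) • (x : H))
  rw [inner_smul_right, norm_smul, Complex.norm_real, mul_pow, Real.norm_eq_abs, sq_abs] at h
  simp only [RCLike.re_to_complex, Complex.re_ofReal_mul] at h
  rw [kgForm, h]
  ring

/-- Factorization of the Klein–Gordon form through two distinct zeros. -/
theorem kgForm_eq_mul_of_roots {H : Type*} [NormedAddCommGroup H] [InnerProductSpace ℂ H]
    {D : Submodule ℂ H} (G V : D →ₗ[ℂ] H) {x : D} {a b : ℝ} (hab : a < b)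
    (ha : kgForm G V a x = 0) (hb : kgForm G V b x = 0) (μ : ℝ) :
    kgForm G V μ x = (μ - a) * (b - μ) * ‖(x : H)‖ ^ 2 := by
  rw [kgForm_eq_quadratic] at ha hb ⊢
  have hlin : 2 * (inner ℂ (V x) (x : H)).re = (a + b) * ‖(x : H)‖ ^ 2 := by
    apply mul_left_cancel₀ (sub_ne_zero.mpr hab.ne')
    linear_combination hb - ha
  linear_combination ha + (μ - a) * hlin

theorem norm_real_combination_sq {H : Type*} [NormedAddCommGroup H] [InnerProductSpace ℂ H]
    (u v : H) (s t : ℝ) :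
    ‖(s : ℂ) • u + (t : ℂ) • v‖ ^ 2 =
      s ^ 2 * ‖u‖ ^ 2 + s * t * (2 * (inner ℂ u v).re) + t ^ 2 * ‖v‖ ^ 2 := by
  rw [norm_add_sq (𝕜 := ℂ), inner_smul_right, inner_smul_left, norm_smul, norm_smul,
    Complex.norm_real, Complex.norm_real, mul_pow, mul_pow, Real.norm_eq_abs, Real.norm_eq_abs,
    sq_abs, sq_abs, Complex.conj_ofReal]
  simp only [RCLike.re_to_complex, Complex.re_ofReal_mul]
  ring

/-- On a real span of two vectors the Klein–Gordon form is a real binary quadratic form. -/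
theorem exists_kgForm_real_combination {H : Type*} [NormedAddCommGroup H]
    [InnerProductSpace ℂ H] {D : Submodule ℂ H} (G V : D →ₗ[ℂ] H) (μ : ℝ) (x y : D) :
    ∃ c : ℝ, ∀ s t : ℝ, kgForm G V μ ((s : ℂ) • x + (t : ℂ) • y) =
      s ^ 2 * kgForm G V μ x + s * t * c + t ^ 2 * kgForm G V μ y := by
  refine ⟨2 * (inner ℂ (G x) (G y)).re -
    2 * (inner ℂ (V x - (μ : ℂ) • (x : H)) (V y - (μ : ℂ) • (y : H))).re, fun s t => ?_⟩
  have hV : V ((s : ℂ) • x + (t : ℂ) • y) -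
      (μ : ℂ) • (((s : ℂ) • x + (t : ℂ) • y : D) : H) =
      (s : ℂ) • (V x - (μ : ℂ) • (x : H)) + (t : ℂ) • (V y - (μ : ℂ) • (y : H)) := by
    simp only [map_add, map_smul, Submodule.coe_add, Submodule.coe_smul]
    module
  simp only [kgForm]
  rw [hV, map_add, map_smul, map_smul, norm_real_combination_sq, norm_real_combination_sq]
  ring

/-- For a strongly damped form polynomial, no lower zero exceeds an upper zero. -/
theorem lower_root_le_upper_root {H : Type*} [NormedAddCommGroup H] [InnerProductSpace ℂ H]
    {D : Submodule ℂ H} (G V : D →ₗ[ℂ] H) (pm pp : D → ℝ)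
    (hlt : ∀ x : D, x ≠ 0 → pm x < pp x)
    (hfac : ∀ x : D, x ≠ 0 → ∀ μ : ℝ,
      kgForm G V μ x = (μ - pm x) * (pp x - μ) * ‖(x : H)‖ ^ 2)
    {x y : D} (hx : x ≠ 0) (hy : y ≠ 0) : pm x ≤ pp y := by
  by_contra! hlt_roots
  obtain ⟨μ, hμy, hμx⟩ := exists_between hlt_roots
  have norm_sq_pos : ∀ z : D, z ≠ 0 → 0 < ‖(z : H)‖ ^ 2 := fun z hz =>
    pow_pos (norm_pos_iff.mpr (by simpa using hz)) 2
  have slope : ∀ z : D, z ≠ 0 → kgForm G V (μ + 1) z - kgForm G V (μ - 1) z =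
      2 * (pm z + pp z - 2 * μ) * ‖(z : H)‖ ^ 2 := fun z hz => by
    rw [hfac z hz, hfac z hz]
    ring
  have hxp := hlt x hx
  have hyp := hlt y hy
  have hnx := norm_sq_pos x hx
  have hny := norm_sq_pos y hy
  have hAx : kgForm G V μ x < 0 := by
    rw [hfac x hx]
    exact mul_neg_of_neg_of_pos (mul_neg_of_neg_of_pos (by linarith) (by linarith)) hnx
  have hAy : kgForm G V μ y < 0 := by
    rw [hfac y hy]
    exact mul_neg_of_neg_of_pos (mul_neg_of_pos_of_neg (by linarith) (by linarith)) hny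
  have hBx : 0 < kgForm G V (μ + 1) x - kgForm G V (μ - 1) x := by
    rw [slope x hx]
    exact mul_pos (by linarith) hnx
  have hBy : kgForm G V (μ + 1) y - kgForm G V (μ - 1) y < 0 := by
    rw [slope y hy]
    exact mul_neg_of_neg_of_pos (by linarith) hny
  obtain ⟨c, hc⟩ := exists_kgForm_real_combination G V μ x y
  obtain ⟨c₁, hc₁⟩ := exists_kgForm_real_combination G V (μ + 1) x y
  obtain ⟨c₂, hc₂⟩ := exists_kgForm_real_combination G V (μ - 1) x y
  obtain ⟨ε, hε, hεc⟩ : ∃ ε : ℝ, ε ^ 2 = 1 ∧ ε * c ≤ 0 := by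
    rcases le_total c 0 with h | h
    · exact ⟨1, by norm_num, by linarith⟩
    · exact ⟨-1, by norm_num, by linarith⟩
  -- The slope at `μ` vanishes somewhere on the segment from `x` to `ε • y`.
  obtain ⟨τ, ⟨hτ0, hτ1⟩, hτ⟩ : (0 : ℝ) ∈
      (fun τ : ℝ => (1 - τ) ^ 2 * (kgForm G V (μ + 1) x - kgForm G V (μ - 1) x) +
        (1 - τ) * (ε * τ) * (c₁ - c₂) +
        τ ^ 2 * (kgForm G V (μ + 1) y - kgForm G V (μ - 1) y)) '' Set.Icc 0 1 := by
    apply intermediate_value_Icc' zero_le_one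
    · fun_prop
    · constructor <;> norm_num <;> linarith
  simp only at hτ
  set z : D := ((1 - τ : ℝ) : ℂ) • x + ((ε * τ : ℝ) : ℂ) • y with hz
  have hBz : kgForm G V (μ + 1) z - kgForm G V (μ - 1) z = 0 := by
    rw [hz, hc₁, hc₂]
    linear_combination hτ + τ ^ 2 * (kgForm G V (μ + 1) y - kgForm G V (μ - 1) y) * hε
  have hAz : kgForm G V μ z < 0 := by
    have hexp : kgForm G V μ z = (1 - τ) ^ 2 * kgForm G V μ x +
        (1 - τ) * τ * (ε * c) + τ ^ 2 * kgForm G V μ y := by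
      rw [hz, hc]
      linear_combination τ ^ 2 * kgForm G V μ y * hε
    rw [hexp]
    have hcross : (1 - τ) * τ * (ε * c) ≤ 0 :=
      mul_nonpos_of_nonneg_of_nonpos (mul_nonneg (by linarith) hτ0) hεc
    rcases hτ0.eq_or_lt with h | h
    · subst h
      linarith
    · have hy_term : τ ^ 2 * kgForm G V μ y < 0 := mul_neg_of_pos_of_neg (pow_pos h 2) hAy
      have hx_term : (1 - τ) ^ 2 * kgForm G V μ x ≤ 0 :=
        mul_nonpos_of_nonneg_of_nonpos (sq_nonneg _) hAx.le
      linarith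
  have hz0 : z ≠ 0 := by
    intro h
    rw [h] at hAz
    simp [kgForm] at hAz
  have hnz := norm_sq_pos z hz0
  have hmid : pm z + pp z - 2 * μ = 0 := by
    rw [slope z hz0] at hBz
    have := (mul_eq_zero.mp hBz).resolve_right hnz.ne'
    linarith
  have hzp := hlt z hz0
  rw [hfac z hz0] at hAz
  exact absurd hAz (not_lt.mpr (mul_nonneg (mul_nonneg (by linarith) (by linarith)) hnz.le))

/-- Proposition 3.4 i): if the form polynomial `t` is strongly damped, then for every
`λ ∈ [ν₋, ν₊]` (where `ν₋ = sup Λ₋`, `ν₊ = inf Λ₊`) and every `x ∈ D`,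
`t(λ)[x] ≥ (λ − ν₋)(ν₊ − λ)‖x‖² ≥ 0`; in particular `t(λ) ≥ 0` on `[ν₋, ν₊]`. -/
theorem form_nonneg_between_root_zones
    {H : Type*} [NormedAddCommGroup H] [InnerProductSpace ℂ H]
    (D : Submodule ℂ H) (G V : D →ₗ[ℂ] H)
    (pm pp : D → ℝ)
    (hsd : ∀ x : D, x ≠ 0 → pm x < pp x ∧
      kgForm G V (pm x) x = 0 ∧ kgForm G V (pp x) x = 0 ∧
      ∀ μ : ℝ, kgForm G V μ x = 0 → μ = pm x ∨ μ = pp x)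
    (hne : ∃ x : D, x ≠ 0) :
    ∀ lam : ℝ, sSup {r : ℝ | ∃ x : D, x ≠ 0 ∧ pm x = r} ≤ lam →
      lam ≤ sInf {r : ℝ | ∃ x : D, x ≠ 0 ∧ pp x = r} →
      ∀ x : D,
        (lam - sSup {r : ℝ | ∃ x : D, x ≠ 0 ∧ pm x = r}) *
            (sInf {r : ℝ | ∃ x : D, x ≠ 0 ∧ pp x = r} - lam) * ‖(x : H)‖ ^ 2 ≤
          kgForm G V lam x ∧
        0 ≤ (lam - sSup {r : ℝ | ∃ x : D, x ≠ 0 ∧ pm x = r}) *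
            (sInf {r : ℝ | ∃ x : D, x ≠ 0 ∧ pp x = r} - lam) * ‖(x : H)‖ ^ 2 := by
  intro lam hlo hhi x
  have hfac : ∀ x : D, x ≠ 0 → ∀ μ : ℝ,
      kgForm G V μ x = (μ - pm x) * (pp x - μ) * ‖(x : H)‖ ^ 2 := fun x hx =>
    kgForm_eq_mul_of_roots G V (hsd x hx).1 (hsd x hx).2.1 (hsd x hx).2.2.1
  have hroots : ∀ x y : D, x ≠ 0 → y ≠ 0 → pm x ≤ pp y := fun x y hx hy =>
    lower_root_le_upper_root G V pm pp (fun x hx => (hsd x hx).1) hfac hx hy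
  obtain ⟨x₀, hx₀⟩ := hne
  have hbdd : BddAbove {r : ℝ | ∃ x : D, x ≠ 0 ∧ pm x = r} := by
    refine ⟨pp x₀, ?_⟩
    rintro _ ⟨y, hy, rfl⟩
    exact hroots y x₀ hy hx₀
  have hbdd' : BddBelow {r : ℝ | ∃ x : D, x ≠ 0 ∧ pp x = r} := by
    refine ⟨pm x₀, ?_⟩
    rintro _ ⟨y, hy, rfl⟩
    exact hroots x₀ y hx₀ hy
  refine ⟨?_, mul_nonneg (mul_nonneg (sub_nonneg.mpr hlo) (sub_nonneg.mpr hhi)) (sq_nonneg _)⟩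
  rcases eq_or_ne x 0 with rfl | hx
  · simp [kgForm]
  have hpm := le_csSup hbdd ⟨x, hx, rfl⟩
  have hpp := csInf_le hbdd' ⟨x, hx, rfl⟩
  rw [hfac x hx]
  apply mul_le_mul_of_nonneg_right _ (sq_nonneg _)
  exact mul_le_mul (by linarith) (by linarith) (by linarith) (by linarith)
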